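/- For every L ≥ 0, k ≥ 0 and h₀ ≥ 0 there exist β, γ ≥ 0 such that the following holds. Let (X, d) be a metric space with a coarse median μ with parameters (k, h) where h(0) = h₀, let (M, μ_M) be a finite median algebra, and let f : M → X be an L-quasi-morphism, i.e. d(f(μ_M(a,b,c)), μ(f(a), f(b), f(c))) ≤ L for all a, b, c ∈ M. If {e₁⁻, e₁⁺} and {e₂⁻, e₂⁺} are edges of M crossing the same wall, then d(f(e₂⁺), f(e₂⁻)) ≤ β·d(f(e₁⁺), f(e₁⁻)) + γ and d(f(e₁⁺), f(e₁⁻)) ≤ β·d(f(e₂⁺), f(e₂⁻)) + γ. -/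

import Mathlib

universe u v

/-- The axioms of a median algebra for a ternary operation. -/
def IsMedianFn {X : Type*} (μ : X → X → X → X) : Prop :=
  (∀ x y z, μ x y z = μ x z y) ∧ (∀ x y z, μ x y z = μ y z x) ∧
    (∀ x y, μ x x y = x) ∧
    ∀ x y z u v, μ (μ x y z) u v = μ x (μ y u v) (μ z u v)

/-- `μ` is a coarse median on `(X, d)` with parameters `(k, h)`. -/
def IsCoarseMedianWith {X : Type*} [MetricSpace X] (μ : X → X → X → X)
    (k : ℝ) (h : ℕ → ℝ) : Prop :=
  0 ≤ k ∧ (∀ i, 0 ≤ h i) ∧ Monotone h ∧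
    (∀ x y z x' y' z' : X,
      dist (μ x y z) (μ x' y' z') ≤ k * (dist x x' + dist y y' + dist z z') + h 0) ∧
    ∀ A : Finset X, A.Nonempty →
      ∃ (M : Type) (_ : Fintype M) (μM : M → M → M → M) (lam : M → X) (proj : X → M),
        IsMedianFn μM ∧
          (∀ a ∈ A, dist a (lam (proj a)) ≤ h A.card) ∧
          ∀ m₁ m₂ m₃ : M,
            dist (lam (μM m₁ m₂ m₃)) (μ (lam m₁) (lam m₂) (lam m₃)) ≤ h A.card

/-- `μ` is a coarse median on `(X, d)`. -/
def IsCoarseMedian {X : Type*} [MetricSpace X] (μ : X → X → X → X) : Prop :=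
  ∃ k h, IsCoarseMedianWith μ k h

/-- `f` is a quasi-isometric embedding. -/
def IsQIE {X Y : Type*} [MetricSpace X] [MetricSpace Y] (f : X → Y) : Prop :=
  ∃ α ε : ℝ, 0 < α ∧ 0 ≤ ε ∧ ∀ x x' : X,
    α⁻¹ * dist x x' - ε ≤ dist (f x) (f x') ∧ dist (f x) (f x') ≤ α * dist x x' + ε

/-- `f` is a quasi-isometry with quasi-inverse `g`. -/
def IsQuasiInverse {X Y : Type*} [MetricSpace X] [MetricSpace Y]
    (f : X → Y) (g : Y → X) : Prop :=
  IsQIE f ∧ IsQIE g ∧ (∃ C, ∀ y, dist (f (g y)) y ≤ C) ∧ ∃ C, ∀ x, dist (g (f x)) x ≤ C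

/-- A subset of a median algebra is convex if it contains the interval
`I(a,b) = {z | μ a b z = z}` between any two of its points. -/
def MedConvex {M : Type*} (μM : M → M → M → M) (h : Set M) : Prop :=
  ∀ a ∈ h, ∀ b ∈ h, ∀ z : M, μM a b z = z → z ∈ h

/-- A halfspace: one side of a wall, i.e. a nonempty convex set with nonempty convex
complement.  Walls `{h, hᶜ}` correspond to pairs of complementary halfspaces. -/
def IsHalfspace {M : Type*} (μM : M → M → M → M) (h : Set M) : Prop :=
  h.Nonempty ∧ hᶜ.Nonempty ∧ MedConvex μM h ∧ MedConvex μM hᶜ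

/-- `a` and `b` are adjacent (form an edge) if exactly one wall separates them; separating
walls are represented by the halfspace containing `a` and not `b`. -/
def Adjacent {M : Type*} (μM : M → M → M → M) (a b : M) : Prop :=
  ∃! h : Set M, IsHalfspace μM h ∧ a ∈ h ∧ b ∉ h

/-- The edge `{a, b}` crosses the wall `{w, wᶜ}`: `a, b` are adjacent and the wall
separates them. -/
def EdgeCrosses {M : Type*} (μM : M → M → M → M) (w : Set M) (a b : M) : Prop :=
  Adjacent μM a b ∧ ((a ∈ w ∧ b ∉ w) ∨ (b ∈ w ∧ a ∉ w))

theorem IsMedianFn.median_median_left {M : Type*} {μM : M → M → M → M}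
    (hM : IsMedianFn μM) (a b c : M) : μM a b (μM a b c) = μM a b c := by
  obtain ⟨h₁, h₂, h₃, h₄⟩ := hM
  have h := h₄ c a b a b
  rw [h₃, h₂ b a b, h₂ a b b, h₃, h₂ c a b] at h
  rw [h₂ a b, h₂ b, h]

theorem IsMedianFn.interval_trans {M : Type*} {μM : M → M → M → M} (hM : IsMedianFn μM)
    {y p q r : M} (hq : μM y p q = q) (hr : μM y q r = r) : μM y p r = r := by
  obtain ⟨h₁, h₂, h₃, h₄⟩ := hM
  have h := h₄ p q y y r
  rw [h₃, ← h₂ y p q, hq, h₂ q y r, h₁ y r q, hr, ← h₂ y p r] at h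
  exact h.symm

theorem IsMedianFn.medConvex_gate_fiber {M : Type*} {μM : M → M → M → M}
    (hM : IsMedianFn μM) (y p q : M) : MedConvex μM {z | μM y p z = q} := by
  obtain ⟨h₁, h₂, h₃, h₄⟩ := hM
  intro a ha b hb z hz
  simp only [Set.mem_ofPred_eq] at ha hb ⊢
  have h := h₄ z a b y p
  rw [h₂ z a b, hz, h₂ a y p, ha, h₂ b y p, hb, h₂ z q q, h₃, h₂ z y p] at h
  exact h

/-- In a finite median algebra, an initial point of a nontrivial interval has an atom above it. -/
theorem IsMedianFn.exists_atom {M : Type*} [Finite M] {μM : M → M → M → M}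
    (hM : IsMedianFn μM) {x y : M} (hxy : x ≠ y) :
    ∃ p, p ≠ y ∧ μM y x p = p ∧ ∀ q, μM y p q = q → q = y ∨ q = p := by
  obtain ⟨p, ⟨hpy, hpx⟩, hmin⟩ :=
    (Set.toFinite {p : M | p ≠ y ∧ μM y x p = p}).exists_minimalFor
      (fun p => {r | μM y p r = r}) _
      ⟨x, hxy, by rw [hM.2.1 y x x, hM.2.2.1]⟩
  refine ⟨p, hpy, hpx, fun q hq => or_iff_not_imp_left.2 fun hqy => ?_⟩
  have hle := hmin (j := q) ⟨hqy, hM.interval_trans hpx hq⟩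
    (fun r hr => hM.interval_trans hq hr)
  have hp : μM y q p = p := hle (by
    change μM y p p = p
    rw [hM.2.1 y p p, hM.2.2.1])
  rw [← hq, hM.1, hp]

theorem IsMedianFn.exists_isHalfspace_separating {M : Type*} [Finite M]
    {μM : M → M → M → M} (hM : IsMedianFn μM) {x y : M} (hxy : x ≠ y) :
    ∃ h, IsHalfspace μM h ∧ x ∈ h ∧ y ∉ h := by
  obtain ⟨p, hpy, hpx, hatom⟩ := hM.exists_atom hxy
  have hproj (z : M) : μM y p z = y ∨ μM y p z = p :=
    hatom _ (hM.median_median_left y p z)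
  have hyy : μM y p y = y := by rw [← hM.2.1 y y p, hM.2.2.1]
  have hx : μM y p x = p := by rw [hM.1, hpx]
  have hcompl : {z | μM y p z = p}ᶜ = {z | μM y p z = y} := by
    ext z
    simp only [Set.mem_compl_iff, Set.mem_ofPred_eq]
    exact ⟨(hproj z).resolve_right, fun h h' => hpy (h'.symm.trans h)⟩
  refine ⟨{z | μM y p z = p}, ⟨⟨x, hx⟩, ?_, hM.medConvex_gate_fiber y p p, ?_⟩, hx, ?_⟩
  · rw [hcompl]
    exact ⟨y, hyy⟩
  · rw [hcompl]
    exact hM.medConvex_gate_fiber y p y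
  · exact fun h => hpy (h.symm.trans hyy)

theorem IsHalfspace.compl {M : Type*} {μM : M → M → M → M} {w : Set M}
    (hw : IsHalfspace μM w) : IsHalfspace μM wᶜ := by
  obtain ⟨h₁, h₂, h₃, h₄⟩ := hw
  exact ⟨h₂, by rwa [compl_compl], h₄, by rwa [compl_compl]⟩

theorem Adjacent.symm {M : Type*} {μM : M → M → M → M} {a b : M}
    (h : Adjacent μM a b) : Adjacent μM b a := by
  obtain ⟨w, ⟨hw, ha, hb⟩, huniq⟩ := h
  refine ⟨wᶜ, ⟨hw.compl, hb, not_not.2 ha⟩, fun v ⟨hv, hbv, hav⟩ => ?_⟩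
  rw [← huniq vᶜ ⟨hv.compl, hav, not_not.2 hbv⟩, compl_compl]

theorem MedConvex.median_mem {M : Type*} {μM : M → M → M → M} (hM : IsMedianFn μM)
    {s : Set M} (hs : MedConvex μM s) {a b : M} (ha : a ∈ s) (hb : b ∈ s) (c : M) :
    μM a b c ∈ s :=
  hs a ha b hb _ (hM.median_median_left a b c)

/-- A point projects onto an edge as the endpoint lying on its own side of the wall. -/
theorem Adjacent.median_eq_right {M : Type*} [Finite M] {μM : M → M → M → M}
    (hM : IsMedianFn μM) {a b c : M} {w : Set M} (hab : Adjacent μM a b)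
    (hw : IsHalfspace μM w) (ha : a ∈ w) (hb : b ∉ w) (hc : c ∉ w) : μM a b c = b := by
  have hm : μM a b c ∉ w := by
    rw [hM.2.1]
    exact hw.2.2.2.median_mem hM hb hc a
  by_contra hne
  obtain ⟨v, hv, hmv, hbv⟩ := hM.exists_isHalfspace_separating hne
  have hav : a ∈ v := by
    by_contra hav
    exact hv.2.2.2.median_mem hM hav hbv c hmv
  exact hm (hab.unique ⟨hw, ha, hb⟩ ⟨hv, hav, hbv⟩ ▸ hmv)

theorem Adjacent.median_eq_left {M : Type*} [Finite M] {μM : M → M → M → M}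
    (hM : IsMedianFn μM) {a b c : M} {w : Set M} (hab : Adjacent μM a b)
    (hw : IsHalfspace μM w) (ha : a ∈ w) (hb : b ∉ w) (hc : c ∈ w) : μM a b c = a := by
  rw [hM.2.1, hM.1]
  exact hab.symm.median_eq_right hM hw.compl hb (not_not.2 ha) (not_not.2 hc)

theorem Adjacent.dist_map_le {X M : Type*} [MetricSpace X] [Finite M]
    {μ : X → X → X → X} {μM : M → M → M → M} {f : M → X} {k h₀ L : ℝ}
    (hμ : ∀ x y z x' y' z' : X,
      dist (μ x y z) (μ x' y' z') ≤ k * (dist x x' + dist y y' + dist z z') + h₀)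
    (hM : IsMedianFn μM)
    (hf : ∀ a b c : M, dist (f (μM a b c)) (μ (f a) (f b) (f c)) ≤ L)
    {a b a' b' : M} {w : Set M} (hw : IsHalfspace μM w) (hab' : Adjacent μM a' b')
    (ha : a ∈ w) (hb : b ∉ w) (ha' : a' ∈ w) (hb' : b' ∉ w) :
    dist (f a') (f b') ≤ k * dist (f a) (f b) + (h₀ + 2 * L) := by
  have h₁ := hf a' b' a
  have h₂ := hf a' b' b
  have h₃ := hμ (f a') (f b') (f a) (f a') (f b') (f b)
  rw [hab'.median_eq_left hM hw ha' hb' ha] at h₁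
  rw [hab'.median_eq_right hM hw ha' hb' hb, dist_comm] at h₂
  simp only [dist_self, zero_add] at h₃
  have := dist_triangle4 (f a') (μ (f a') (f b') (f a)) (μ (f a') (f b') (f b)) (f b')
  linarith

theorem EdgeCrosses.dist_map_le {X M : Type*} [MetricSpace X] [Finite M]
    {μ : X → X → X → X} {μM : M → M → M → M} {f : M → X} {k h₀ L : ℝ}
    (hμ : ∀ x y z x' y' z' : X,
      dist (μ x y z) (μ x' y' z') ≤ k * (dist x x' + dist y y' + dist z z') + h₀)
    (hM : IsMedianFn μM)
    (hf : ∀ a b c : M, dist (f (μM a b c)) (μ (f a) (f b) (f c)) ≤ L)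
    {a b a' b' : M} {w : Set M} (hw : IsHalfspace μM w)
    (hab : EdgeCrosses μM w a b) (hab' : EdgeCrosses μM w a' b') :
    dist (f b') (f a') ≤ k * dist (f b) (f a) + (h₀ + 2 * L) := by
  obtain ⟨-, hs⟩ := hab
  obtain ⟨hadj', hs'⟩ := hab'
  rcases hs with ⟨h, h'⟩ | ⟨h, h'⟩ <;> rcases hs' with ⟨g, g'⟩ | ⟨g, g'⟩
  · rw [dist_comm (f b'), dist_comm (f b)]
    exact hadj'.dist_map_le hμ hM hf hw h h' g g'
  · rw [dist_comm (f b)]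
    exact hadj'.symm.dist_map_le hμ hM hf hw h h' g g'
  · rw [dist_comm (f b')]
    exact hadj'.dist_map_le hμ hM hf hw h h' g g'
  · exact hadj'.symm.dist_map_le hμ hM hf hw h h' g g'


/-- For every `L ≥ 0`, `k ≥ 0`, `h₀ ≥ 0` there are `β, γ ≥ 0` such that for
every coarse median `μ` with parameters `(k, h)`, `h 0 = h₀`, on a metric space `X`, every
finite median algebra `(M, μM)` and every `L`-quasi-morphism `f : M → X`, the images of
any two parallel edges (edges crossing the same wall) of `M` have comparable lengths:
`d(f e₂⁺, f e₂⁻) ≤ β·d(f e₁⁺, f e₁⁻) + γ` and vice versa. -/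
theorem stmt_17 (L k h₀ : ℝ) (hL : 0 ≤ L) (hk : 0 ≤ k) (hh₀ : 0 ≤ h₀) :
    ∃ β γ : ℝ, 0 ≤ β ∧ 0 ≤ γ ∧
      ∀ (X : Type u) [MetricSpace X] (μ : X → X → X → X) (h : ℕ → ℝ),
        IsCoarseMedianWith μ k h → h 0 = h₀ →
        ∀ (M : Type v) [Fintype M] (μM : M → M → M → M), IsMedianFn μM →
          ∀ f : M → X, (∀ a b c : M, dist (f (μM a b c)) (μ (f a) (f b) (f c)) ≤ L) →
            ∀ (w : Set M) (e₁m e₁p e₂m e₂p : M), IsHalfspace μM w →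
              EdgeCrosses μM w e₁m e₁p → EdgeCrosses μM w e₂m e₂p →
              dist (f e₂p) (f e₂m) ≤ β * dist (f e₁p) (f e₁m) + γ ∧
                dist (f e₁p) (f e₁m) ≤ β * dist (f e₂p) (f e₂m) + γ := by
  refine ⟨k, h₀ + 2 * L, hk, by positivity, ?_⟩
  intro X _ μ h hμ rfl M _ μM hM f hf w e₁m e₁p e₂m e₂p hw h₁ h₂
  exact ⟨h₁.dist_map_le hμ.2.2.2.1 hM hf hw h₂, h₂.dist_map_le hμ.2.2.2.1 hM hf hw h₁⟩
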